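/- Let 𝔼 = ⟨ℰ, B⟩ be an epistemic space and ∘ an extended credibility-limited revision operator for 𝔼. For each Ψ ∈ ℰ define C_Ψ = {ω ∈ Ω : ⟦Ψ∘φ_ω⟧ = {ω}} and define, for ω₁, ω₂ ∈ C_Ψ, ω₁ ⪯_Ψ ω₂ iff ω₁ ∈ ⟦Ψ∘φ_{ω₁,ω₂}⟧, where φ_{ω₁,ω₂} is any formula with ⟦φ_{ω₁,ω₂}⟧ = {ω₁, ω₂}. Then ⪯_Ψ is a total preorder on C_Ψ: it is total (for all ω₁, ω₂ ∈ C_Ψ, ω₁ ⪯_Ψ ω₂ or ω₂ ⪯_Ψ ω₁) and transitive. -/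

import Mathlib

namespace CLR

/-- Propositional formulas over a signature `V` (with falsum `⊥` and implication;
other connectives are defined). -/
inductive Form (V : Type) : Type
  | atom : V → Form V
  | fls  : Form V
  | imp  : Form V → Form V → Form V

namespace Form

variable {V : Type}

/-- Negation `¬φ := φ → ⊥`. -/
def neg (φ : Form V) : Form V := Form.imp φ Form.fls

/-- Verum `⊤ := ¬⊥`. -/
def tru : Form V := neg (Form.fls : Form V)

/-- Disjunction `φ ∨ ψ := ¬φ → ψ`. -/
def or' (φ ψ : Form V) : Form V := Form.imp (neg φ) ψ

/-- Conjunction `φ ∧ ψ := ¬(¬φ ∨ ¬ψ)`. -/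
def and' (φ ψ : Form V) : Form V := neg (or' (neg φ) (neg ψ))

/-- Evaluation of a formula in an interpretation `w : V → Bool`. -/
def eval (w : V → Bool) : Form V → Bool
  | atom v => w v
  | fls => false
  | imp φ ψ => !(eval w φ) || eval w ψ

end Form

/-- Interpretations (possible worlds) over signature `V`. -/
abbrev World (V : Type) := V → Bool

/-- The set of models `⟦φ⟧` of a formula. -/
def mods {V : Type} (φ : Form V) : Set (World V) := {w | φ.eval w = true}

/-- The set of models `⟦X⟧` of a set of formulas. -/
def modsSet {V : Type} (X : Set (Form V)) : Set (World V) :=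
  {w | ∀ φ ∈ X, φ.eval w = true}

/-- Deductive closure (via semantic entailment, which is adequate for
classical propositional logic). -/
def Cn {V : Type} (X : Set (Form V)) : Set (Form V) :=
  {φ | ∀ w ∈ modsSet X, w ∈ mods φ}

/-- Expansion: `X + α` is the deductive closure of `X ∪ {α}`. -/
def plus {V : Type} (X : Set (Form V)) (α : Form V) : Set (Form V) :=
  Cn (X ∪ {α})

/-- A formula is consistent if it has a model. -/
def FormConsistent {V : Type} (φ : Form V) : Prop := (mods φ).Nonempty

/-- A set of formulas is consistent if it has a model. -/
def SetConsistent {V : Type} (X : Set (Form V)) : Prop := (modsSet X).Nonempty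

/-- An epistemic space `𝔼 = ⟨ℰ, B⟩`: each epistemic state `Ψ : E` has a
deductively closed belief set `B Ψ`. -/
structure EpistemicSpace (V E : Type) where
  B : E → Set (Form V)
  closed : ∀ Ψ, B Ψ = Cn (B Ψ)

variable {V E : Type}

/-- Models `⟦Ψ⟧` of the belief set of an epistemic state. -/
def modsOf (ES : EpistemicSpace V E) (Ψ : E) : Set (World V) := modsSet (ES.B Ψ)

/-- (R1) `α ∈ B(Ψ∘α)`. -/
def R1 (ES : EpistemicSpace V E) (circ : E → Form V → E) : Prop :=
  ∀ Ψ α, α ∈ ES.B (circ Ψ α)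

/-- (R2) `B(Ψ∘α) = B(Ψ)+α` whenever `B(Ψ)+α` is consistent. -/
def R2 (ES : EpistemicSpace V E) (circ : E → Form V → E) : Prop :=
  ∀ Ψ α, SetConsistent (plus (ES.B Ψ) α) → ES.B (circ Ψ α) = plus (ES.B Ψ) α

/-- (R3) if `α` is consistent then `B(Ψ∘α)` is consistent. -/
def R3 (ES : EpistemicSpace V E) (circ : E → Form V → E) : Prop :=
  ∀ Ψ α, FormConsistent α → SetConsistent (ES.B (circ Ψ α))

/-- (R4) if `α ≡ β` then `B(Ψ∘α) = B(Ψ∘β)`. -/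
def R4 (ES : EpistemicSpace V E) (circ : E → Form V → E) : Prop :=
  ∀ Ψ α β, mods α = mods β → ES.B (circ Ψ α) = ES.B (circ Ψ β)

/-- (R5) `B(Ψ∘(α∧β)) ⊆ B(Ψ∘α)+β`. -/
def R5 (ES : EpistemicSpace V E) (circ : E → Form V → E) : Prop :=
  ∀ Ψ α β, ES.B (circ Ψ (Form.and' α β)) ⊆ plus (ES.B (circ Ψ α)) β

/-- (R6) if `B(Ψ∘α)+β` is consistent then `B(Ψ∘α)+β ⊆ B(Ψ∘(α∧β))`. -/
def R6 (ES : EpistemicSpace V E) (circ : E → Form V → E) : Prop :=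
  ∀ Ψ α β, SetConsistent (plus (ES.B (circ Ψ α)) β) →
    plus (ES.B (circ Ψ α)) β ⊆ ES.B (circ Ψ (Form.and' α β))

/-- AGM revision operator: satisfies (R1)–(R6). -/
def AGMRev (ES : EpistemicSpace V E) (circ : E → Form V → E) : Prop :=
  R1 ES circ ∧ R2 ES circ ∧ R3 ES circ ∧ R4 ES circ ∧ R5 ES circ ∧ R6 ES circ

/-- (CL1) `α ∈ B(Ψ∘α)` or `B(Ψ∘α) = B(Ψ)`. -/
def CL1 (ES : EpistemicSpace V E) (circ : E → Form V → E) : Prop :=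
  ∀ Ψ α, α ∈ ES.B (circ Ψ α) ∨ ES.B (circ Ψ α) = ES.B Ψ

/-- (CL2) `B(Ψ∘α) = B(Ψ)+α` whenever `B(Ψ)+α` is consistent. -/
def CL2 (ES : EpistemicSpace V E) (circ : E → Form V → E) : Prop :=
  ∀ Ψ α, SetConsistent (plus (ES.B Ψ) α) → ES.B (circ Ψ α) = plus (ES.B Ψ) α

/-- (CL3) `B(Ψ∘α)` is consistent. -/
def CL3 (ES : EpistemicSpace V E) (circ : E → Form V → E) : Prop :=
  ∀ Ψ α, SetConsistent (ES.B (circ Ψ α))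

/-- (CL4) if `α ≡ β` then `B(Ψ∘α) = B(Ψ∘β)`. -/
def CL4 (ES : EpistemicSpace V E) (circ : E → Form V → E) : Prop :=
  ∀ Ψ α β, mods α = mods β → ES.B (circ Ψ α) = ES.B (circ Ψ β)

/-- (CL5) if `α ∈ B(Ψ∘α)` and `α ⊨ β` then `β ∈ B(Ψ∘β)`. -/
def CL5 (ES : EpistemicSpace V E) (circ : E → Form V → E) : Prop :=
  ∀ Ψ α β, α ∈ ES.B (circ Ψ α) → mods α ⊆ mods β → β ∈ ES.B (circ Ψ β)

/-- (CL6) `B(Ψ∘(α∨β))` equals `B(Ψ∘α)`, or `B(Ψ∘β)`, or `B(Ψ∘α) ∩ B(Ψ∘β)`. -/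
def CL6 (ES : EpistemicSpace V E) (circ : E → Form V → E) : Prop :=
  ∀ Ψ α β,
    ES.B (circ Ψ (Form.or' α β)) = ES.B (circ Ψ α) ∨
    ES.B (circ Ψ (Form.or' α β)) = ES.B (circ Ψ β) ∨
    ES.B (circ Ψ (Form.or' α β)) = ES.B (circ Ψ α) ∩ ES.B (circ Ψ β)

/-- Credibility-limited revision operator: satisfies (CL1)–(CL6). -/
def CLRev (ES : EpistemicSpace V E) (circ : E → Form V → E) : Prop :=
  CL1 ES circ ∧ CL2 ES circ ∧ CL3 ES circ ∧ CL4 ES circ ∧ CL5 ES circ ∧ CL6 ES circ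

/-- (ECL1) = (CL1). -/
def ECL1 (ES : EpistemicSpace V E) (circ : E → Form V → E) : Prop :=
  ∀ Ψ α, α ∈ ES.B (circ Ψ α) ∨ ES.B (circ Ψ α) = ES.B Ψ

/-- (ECL2) = (CL2). -/
def ECL2 (ES : EpistemicSpace V E) (circ : E → Form V → E) : Prop :=
  ∀ Ψ α, SetConsistent (plus (ES.B Ψ) α) → ES.B (circ Ψ α) = plus (ES.B Ψ) α

/-- (ECL3) if `B(Ψ∘α)` is inconsistent then `B(Ψ)` or `α` is inconsistent. -/
def ECL3 (ES : EpistemicSpace V E) (circ : E → Form V → E) : Prop :=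
  ∀ Ψ α, ¬ SetConsistent (ES.B (circ Ψ α)) →
    ¬ SetConsistent (ES.B Ψ) ∨ ¬ FormConsistent α

/-- (ECL4) if `B(Ψ∘α)` is consistent and `α ⊨ β` then `B(Ψ∘β)` is consistent. -/
def ECL4 (ES : EpistemicSpace V E) (circ : E → Form V → E) : Prop :=
  ∀ Ψ α β, SetConsistent (ES.B (circ Ψ α)) → mods α ⊆ mods β →
    SetConsistent (ES.B (circ Ψ β))

/-- (ECL5) = (CL4). -/
def ECL5 (ES : EpistemicSpace V E) (circ : E → Form V → E) : Prop :=
  ∀ Ψ α β, mods α = mods β → ES.B (circ Ψ α) = ES.B (circ Ψ β)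

/-- (ECL6) = (CL5). -/
def ECL6 (ES : EpistemicSpace V E) (circ : E → Form V → E) : Prop :=
  ∀ Ψ α β, α ∈ ES.B (circ Ψ α) → mods α ⊆ mods β → β ∈ ES.B (circ Ψ β)

/-- (ECL7) = (CL6). -/
def ECL7 (ES : EpistemicSpace V E) (circ : E → Form V → E) : Prop :=
  ∀ Ψ α β,
    ES.B (circ Ψ (Form.or' α β)) = ES.B (circ Ψ α) ∨
    ES.B (circ Ψ (Form.or' α β)) = ES.B (circ Ψ β) ∨
    ES.B (circ Ψ (Form.or' α β)) = ES.B (circ Ψ α) ∩ ES.B (circ Ψ β)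

/-- Extended credibility-limited revision operator: satisfies (ECL1)–(ECL7). -/
def ECLRev (ES : EpistemicSpace V E) (circ : E → Form V → E) : Prop :=
  ECL1 ES circ ∧ ECL2 ES circ ∧ ECL3 ES circ ∧ ECL4 ES circ ∧
    ECL5 ES circ ∧ ECL6 ES circ ∧ ECL7 ES circ

/-- `min(X,⪯) = {ω ∈ X : ω ⪯ ω' for all ω' ∈ X}`. -/
def minSet {W : Type} (X : Set W) (le : W → W → Prop) : Set W :=
  {ω ∈ X | ∀ ω' ∈ X, le ω ω'}

/-- The data of a credibility-limited assignment `Ψ ↦ (⪯_Ψ, C_Ψ, b_Ψ)`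
(with `b_Ψ = ⊤` rendered as `true`, `b_Ψ = ⊥` as `false`). -/
structure CLAssignment (V E : Type) where
  le : E → World V → World V → Prop
  C : E → Set (World V)
  b : E → Bool

/-- `A` is a credibility-limited assignment for `ES`: `⟦Ψ⟧ ⊆ C_Ψ`,
`⪯_Ψ` is a total preorder on `C_Ψ`, and (CLA⊥): if `b_Ψ = ⊥` then `C_Ψ = Ω`. -/
def IsCLAssignment (ES : EpistemicSpace V E) (A : CLAssignment V E) : Prop :=
  (∀ Ψ, modsOf ES Ψ ⊆ A.C Ψ) ∧
  (∀ Ψ, ∀ ω₁ ∈ A.C Ψ, ∀ ω₂ ∈ A.C Ψ, A.le Ψ ω₁ ω₂ ∨ A.le Ψ ω₂ ω₁) ∧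
  (∀ Ψ, ∀ ω₁ ∈ A.C Ψ, ∀ ω₂ ∈ A.C Ψ, ∀ ω₃ ∈ A.C Ψ,
      A.le Ψ ω₁ ω₂ → A.le Ψ ω₂ ω₃ → A.le Ψ ω₁ ω₃) ∧
  (∀ Ψ, A.b Ψ = false → A.C Ψ = Set.univ)

/-- Faithfulness: (CLFA1) and (CLFA2). -/
def Faithful (ES : EpistemicSpace V E) (A : CLAssignment V E) : Prop :=
  (∀ (Ψ : E) (ω₁ ω₂ : World V), ω₁ ∈ modsOf ES Ψ → ω₂ ∈ modsOf ES Ψ →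
      A.le Ψ ω₁ ω₂ ∧ A.le Ψ ω₂ ω₁) ∧
  (∀ (Ψ : E) (ω₁ ω₂ : World V), ω₁ ∈ modsOf ES Ψ → ω₂ ∉ modsOf ES Ψ →
      A.le Ψ ω₁ ω₂ ∧ ¬ A.le Ψ ω₂ ω₁)

/-- Revision-compatibility of an assignment with a belief change operator:
`⟦Ψ∘α⟧ = min(⟦α⟧,⪯_Ψ)` if `⟦α⟧ ∩ C_Ψ ≠ ∅`; `⟦Ψ∘α⟧ = ∅` if `⟦α⟧ = ∅` and
`b_Ψ = ⊥`; and `⟦Ψ∘α⟧ = ⟦Ψ⟧` otherwise. -/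
def RevCompatible (ES : EpistemicSpace V E) (circ : E → Form V → E)
    (A : CLAssignment V E) : Prop :=
  ∀ Ψ α,
    ((mods α ∩ A.C Ψ).Nonempty →
      modsOf ES (circ Ψ α) = minSet (mods α) (A.le Ψ)) ∧
    (mods α = ∅ → A.b Ψ = false → modsOf ES (circ Ψ α) = ∅) ∧
    (¬ (mods α ∩ A.C Ψ).Nonempty → ¬ (mods α = ∅ ∧ A.b Ψ = false) →
      modsOf ES (circ Ψ α) = modsOf ES Ψ)


theorem mods_or' {V : Type} (α β : Form V) : mods (Form.or' α β) = mods α ∪ mods β := by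
  ext w
  simp [mods, Form.or', Form.neg, Form.eval]

/-- The models of the intersection of two belief sets are the models of either. -/
theorem modsSet_inter_belief {V E : Type} (ES : EpistemicSpace V E) (Ψ Φ : E) :
    modsSet (ES.B Ψ ∩ ES.B Φ) = modsOf ES Ψ ∪ modsOf ES Φ := by
  ext w
  constructor
  · intro hw
    by_contra hn
    simp only [modsOf, modsSet, Set.mem_union, Set.mem_ofPred_eq, not_or, not_forall] at hn
    obtain ⟨⟨φ, hφ, hφw⟩, ψ, hψ, hψw⟩ := hn
    have hor : w ∈ mods (Form.or' φ ψ) := by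
      refine hw _ ⟨?_, ?_⟩ <;> rw [ES.closed] <;> intro v hv <;> rw [mods_or']
      · exact Or.inl (hv φ hφ)
      · exact Or.inr (hv ψ hψ)
    rw [mods_or'] at hor
    exact hor.elim hφw hψw
  · rintro (hw | hw) φ hφ
    · exact hw φ hφ.1
    · exact hw φ hφ.2

/-- Semantic trichotomy: the result of revising by a formula equivalent to a disjunction. -/
theorem modsOf_circ_trichotomy {V E : Type} {ES : EpistemicSpace V E}
    {circ : E → Form V → E} (h5 : ECL5 ES circ) (h7 : ECL7 ES circ) (Ψ : E)
    {γ α β : Form V} (hγ : mods γ = mods α ∪ mods β) :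
    modsOf ES (circ Ψ γ) = modsOf ES (circ Ψ α) ∨
    modsOf ES (circ Ψ γ) = modsOf ES (circ Ψ β) ∨
    modsOf ES (circ Ψ γ) = modsOf ES (circ Ψ α) ∪ modsOf ES (circ Ψ β) := by
  have hB := h5 Ψ γ (Form.or' α β) (by rw [hγ, mods_or'])
  rw [← modsSet_inter_belief]
  unfold modsOf
  rw [hB]
  rcases h7 Ψ α β with h | h | h <;> simp [h]

/-- For an extended credibility-limited revision operator, with
`C_Ψ = {ω : ⟦Ψ∘φ_ω⟧ = {ω}}` and `ω₁ ⪯_Ψ ω₂ ↔ ω₁ ∈ ⟦Ψ∘φ_{ω₁,ω₂}⟧`, the relation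
`⪯_Ψ` is total and transitive on `C_Ψ`. -/
theorem stmt14 {V E : Type} [Nonempty V] [Fintype V] [Nonempty E]
    (ES : EpistemicSpace V E) (circ : E → Form V → E)
    (h : ECLRev ES circ)
    (g : World V → Form V) (hg : ∀ ω : World V, mods (g ω) = {ω})
    (f : World V → World V → Form V)
    (hf : ∀ ω₁ ω₂ : World V, mods (f ω₁ ω₂) = {ω₁, ω₂})
    (Ψ : E) :
    (∀ ω₁ ω₂ : World V,
        modsOf ES (circ Ψ (g ω₁)) = {ω₁} → modsOf ES (circ Ψ (g ω₂)) = {ω₂} →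
        ω₁ ∈ modsOf ES (circ Ψ (f ω₁ ω₂)) ∨ ω₂ ∈ modsOf ES (circ Ψ (f ω₂ ω₁))) ∧
    (∀ ω₁ ω₂ ω₃ : World V,
        modsOf ES (circ Ψ (g ω₁)) = {ω₁} → modsOf ES (circ Ψ (g ω₂)) = {ω₂} →
        modsOf ES (circ Ψ (g ω₃)) = {ω₃} →
        ω₁ ∈ modsOf ES (circ Ψ (f ω₁ ω₂)) → ω₂ ∈ modsOf ES (circ Ψ (f ω₂ ω₃)) →
        ω₁ ∈ modsOf ES (circ Ψ (f ω₁ ω₃))) := by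
  obtain ⟨-, -, -, -, h5, -, h7⟩ := h
  have hpair : ∀ ω₁ ω₂ : World V, mods (f ω₁ ω₂) = mods (g ω₁) ∪ mods (g ω₂) := by
    intro ω₁ ω₂
    rw [hf, hg, hg]
    rfl
  constructor
  · intro ω₁ ω₂ h₁ h₂
    have hcomm : modsOf ES (circ Ψ (f ω₂ ω₁)) = modsOf ES (circ Ψ (f ω₁ ω₂)) :=
      congrArg modsSet (h5 Ψ _ _ (by rw [hf, hf, Set.pair_comm]))
    rw [hcomm]
    rcases modsOf_circ_trichotomy h5 h7 Ψ (hpair ω₁ ω₂) with e | e | e <;> simp [e, h₁, h₂]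
  · intro ω₁ ω₂ ω₃ h₁ h₂ h₃ h₁₂ h₂₃
    by_contra hn
    have hne₁₂ : ω₁ ≠ ω₂ := by
      rintro rfl
      exact hn h₂₃
    have hne₂₃ : ω₂ ≠ ω₃ := by
      rintro rfl
      exact hn h₁₂
    have h₁₃ : modsOf ES (circ Ψ (f ω₁ ω₃)) = {ω₃} := by
      rcases modsOf_circ_trichotomy h5 h7 Ψ (hpair ω₁ ω₃) with e | e | e
      · simp [e, h₁] at hn
      · rw [e, h₃]
      · simp [e, h₁] at hn
    have hne₁₃ : ω₁ ≠ ω₃ := by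
      rintro rfl
      simp [h₁₃] at hn
    have t₁ := modsOf_circ_trichotomy h5 h7 Ψ
      (γ := Form.or' (f ω₁ ω₂) (g ω₃)) (α := f ω₁ ω₃) (β := g ω₂)
      (by rw [mods_or', hf, hf, hg, hg]; grind)
    have t₂ := modsOf_circ_trichotomy h5 h7 Ψ (mods_or' (f ω₁ ω₂) (g ω₃))
    have t₃ := modsOf_circ_trichotomy h5 h7 Ψ
      (γ := Form.or' (f ω₁ ω₂) (g ω₃)) (α := f ω₂ ω₃) (β := g ω₁)
      (by rw [mods_or', hf, hf, hg, hg]; grind)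
    rw [h₁₃, h₂] at t₁
    rw [h₃] at t₂
    rw [h₁] at t₃
    have hnot : ω₁ ∉ modsOf ES (circ Ψ (Form.or' (f ω₁ ω₂) (g ω₃))) := by
      rcases t₁ with e | e | e <;> simp [e, hne₁₂, hne₁₃]
    have heq : modsOf ES (circ Ψ (Form.or' (f ω₁ ω₂) (g ω₃))) = {ω₃} := by
      rcases t₂ with e | e | e
      · exact absurd (e ▸ h₁₂) hnot
      · exact e
      · exact absurd (e ▸ Or.inl h₁₂) hnot
    rcases t₃ with e | e | e
    · rw [← e, heq] at h₂₃
      exact hne₂₃ h₂₃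
    · exact hnot (e ▸ rfl)
    · exact hnot (e ▸ Or.inr rfl)

end CLR
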